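/- For any finite non-degenerate network (V,K) with |V| = n and any admissible ν, the filling time T of the IDLA(K,ν) process satisfies E[T] ≥ n(log n − log log n − 1) / Σ_{x∈V} p(x), where p(x) := P_ν(τ_x < τ_†). -/

import Mathlib

open scoped ENNReal BigOperators
open Filter Asymptotics

namespace ARW

variable {V : Type} [Fintype V] [DecidableEq V]

/-- A sub-stochastic matrix: every row sums to at most `1`. -/
def SubStochastic (K : V → V → ℝ≥0∞) : Prop := ∀ x, ∑ y, K x y ≤ 1

/-- Non-degenerate: no principal sub-matrix of `K` is stochastic. -/
def NonDegenerate (K : V → V → ℝ≥0∞) : Prop :=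
  ∀ S : Finset V, S.Nonempty → ∃ x ∈ S, ∑ y ∈ S, K x y ≠ 1

/-- A probability vector on `V`. -/
def IsProbVec (ν : V → ℝ≥0∞) : Prop := ∑ x, ν x = 1

/-- Probability that the `K`-walk currently at `x` next follows the trajectory `xs`
and is then killed. -/
noncomputable def pathProb (K : V → V → ℝ≥0∞) : V → List V → ℝ≥0∞
  | x, [] => 1 - ∑ y, K x y
  | x, y :: ys => K x y * pathProb K y ys

/-- Probability that a `(K,ν)`-walk has the (finite) full trajectory `w`. -/
noncomputable def walkProb (K : V → V → ℝ≥0∞) (ν : V → ℝ≥0∞) : List V → ℝ≥0∞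
  | [] => 0
  | x :: xs => ν x * pathProb K x xs

/-- `p(x)`: the probability that a `(K,ν)`-walk visits `x` before dying. -/
noncomputable def hitProb (K : V → V → ℝ≥0∞) (ν : V → ℝ≥0∞) (x : V) : ℝ≥0∞ :=
  ∑' w : List V, if x ∈ w then walkProb K ν w else 0

/-- The insertion law `ν` is admissible when every site has a chance of being
visited by a `(K,ν)`-walk. -/
def Admissible (K : V → V → ℝ≥0∞) (ν : V → ℝ≥0∞) : Prop := ∀ x, 0 < hitProb K ν x

/-- The uniform law on `V`. -/
noncomputable def unifLaw (V : Type) [Fintype V] : V → ℝ≥0∞ :=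
  fun _ => (Fintype.card V : ℝ≥0∞)⁻¹

/-! ### IDLA -/

/-- The IDLA update: the walker settles at the first site of its trajectory
which is not already occupied. -/
def idlaUpdate (S : Finset V) : List V → Finset V
  | [] => S
  | x :: xs => if x ∈ S then idlaUpdate S xs else insert x S

/-- The IDLA aggregate obtained from the initial set `A` after using the walks `ws`. -/
def idlaSet (A : Finset V) (ws : List (List V)) : Finset V := ws.foldl idlaUpdate A

/-- `P(T^A > t)`: probability that the IDLA process started from `A` and driven by
i.i.d. `(K,ν)`-walks has not filled `V` after `t` steps. -/
noncomputable def idlaTail (K : V → V → ℝ≥0∞) (ν : V → ℝ≥0∞) (A : Finset V) (t : ℕ) : ℝ≥0∞ :=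
  ∑' ws : Fin t → List V,
    (∏ i, walkProb K ν (ws i)) * (if idlaSet A (List.ofFn ws) = Finset.univ then 0 else 1)

/-- `E[T^A]`: the expected filling time of IDLA started from `A`. -/
noncomputable def idlaMean (K : V → V → ℝ≥0∞) (ν : V → ℝ≥0∞) (A : Finset V) : ℝ≥0∞ :=
  ∑' t : ℕ, idlaTail K ν A t

/-- `Var(T^A)`: the variance of the filling time of IDLA started from `A`. -/
noncomputable def idlaVar (K : V → V → ℝ≥0∞) (ν : V → ℝ≥0∞) (A : Finset V) : ℝ≥0∞ :=
  (∑' t : ℕ, (2 * t + 1) * idlaTail K ν A t) - (idlaMean K ν A) ^ 2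

/-! ### The ARW chain -/

/-- The state of a single site: empty, one sleeping particle, or `n+1` active particles. -/
inductive Site : Type
  | empty : Site
  | sleeping : Site
  | active (n : ℕ) : Site
deriving DecidableEq

/-- A configuration of particles. -/
abbrev Conf (V : Type) := V → Site

def Site.isActive : Site → Bool
  | .active _ => true
  | _ => false

/-- The set of sites holding at least one active particle. -/
def activeSites (η : Conf V) : Finset V := Finset.univ.filter fun x => (η x).isActive

/-- Adding one active particle to a site (waking a sleeping particle if present). -/
def Site.addActive : Site → Site
  | .empty => .active 0
  | .sleeping => .active 1
  | .active n => .active (n + 1)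

/-- Removing one active particle from a site. -/
def Site.removeOne : Site → Site
  | .active (n + 1) => .active n
  | _ => .empty

/-- Adding one active particle at site `y`. -/
def addActiveAt (η : Conf V) (y : V) : Conf V := Function.update η y (η y).addActive

/-- One sequential toppling step of ARW stabilization with sleep rate `lam`:
an active site `x` is selected (if any); if its particle is alone it falls asleep
with probability `lam/(1+lam)`, moves to `y` with probability `K x y/(1+lam)` and
dies with the remaining probability; if it is not alone it moves to `y` with
probability `K x y` and dies with the remaining probability.  Stable
configurations are absorbing. -/
noncomputable def toppleKernel (K : V → V → ℝ≥0∞) (lam : ℝ) (η ξ : Conf V) : ℝ≥0∞ :=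
  if h : (activeSites η).Nonempty then
    let x := h.choose
    let ημ : Conf V := Function.update η x (η x).removeOne
    let move : ℝ≥0∞ := ∑ y, if ξ = addActiveAt ημ y then K x y else 0
    let die : ℝ≥0∞ := if ξ = ημ then 1 - ∑ y, K x y else 0
    if η x = Site.active 0 then
      ((if ξ = Function.update η x Site.sleeping then ENNReal.ofReal lam else 0) + move + die)
        / (ENNReal.ofReal lam + 1)
    else move + die
  else if ξ = η then 1 else 0

/-- Iterates of a sub-probability kernel on configurations. -/
noncomputable def kernelPow (M : Conf V → Conf V → ℝ≥0∞) : ℕ → Conf V → Conf V → ℝ≥0∞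
  | 0 => fun η ξ => if ξ = η then 1 else 0
  | t + 1 => fun η ξ => ∑' σ : Conf V, M η σ * kernelPow M t σ ξ

/-- A stable configuration, seen as a configuration (`true` = sleeping particle). -/
def embed (b : V → Bool) : Conf V := fun x => if b x then Site.sleeping else Site.empty

/-- One step of the `ARW(K,lam,ν)` chain: insert an active particle at a `ν`-distributed
site and stabilize; `arwStep K lam ν η ξ` is the probability of reaching the stable
configuration `ξ` from the stable configuration `η`. -/
noncomputable def arwStep (K : V → V → ℝ≥0∞) (lam : ℝ) (ν : V → ℝ≥0∞)
    (η ξ : V → Bool) : ℝ≥0∞ :=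
  ∑ x, ν x * ⨆ t, kernelPow (toppleKernel K lam) t (addActiveAt (embed η) x) (embed ξ)

/-- The transition matrix of the `ARW(K,lam,ν)` chain on stable configurations. -/
noncomputable def arwMatrix (K : V → V → ℝ≥0∞) (lam : ℝ) (ν : V → ℝ≥0∞) :
    Matrix (V → Bool) (V → Bool) ℝ :=
  Matrix.of fun η ξ => (arwStep K lam ν η ξ).toReal

/-! ### Distances to equilibrium, mixing and relaxation times -/

variable {S : Type} [Fintype S] [DecidableEq S]

/-- `π` is a stationary probability distribution for `P`. -/
def IsStationary (P : Matrix S S ℝ) (π : S → ℝ) : Prop :=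
  (∀ s, 0 ≤ π s) ∧ (∑ s, π s = 1) ∧ ∀ s, ∑ r, π r * P r s = π s

/-- The separation distance to equilibrium at time `t`. -/
noncomputable def sepDist (P : Matrix S S ℝ) (π : S → ℝ) (t : ℕ) : ℝ :=
  ⨆ η, ⨆ ξ, (1 - (P ^ t) η ξ / π ξ)

/-- The separation mixing time with precision `ε`. -/
noncomputable def sepMix (P : Matrix S S ℝ) (π : S → ℝ) (ε : ℝ) : ℕ :=
  sInf {t : ℕ | sepDist P π t ≤ ε}

/-- The total-variation distance to equilibrium at time `t`. -/
noncomputable def tvDist (P : Matrix S S ℝ) (π : S → ℝ) (t : ℕ) : ℝ :=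
  ⨆ η, ⨆ A : Finset S, |∑ ξ ∈ A, ((P ^ t) η ξ - π ξ)|

/-- The total-variation mixing time with precision `ε`. -/
noncomputable def tvMix (P : Matrix S S ℝ) (π : S → ℝ) (ε : ℝ) : ℕ :=
  sInf {t : ℕ | tvDist P π t ≤ ε}

/-- The relaxation time `1/(1-ρ)`, where `ρ` is the largest modulus of the
(complex) eigenvalues of `P` other than `1`. -/
noncomputable def relTime (P : Matrix S S ℝ) : ℝ :=
  (1 - sSup {r : ℝ | ∃ z : ℂ,
      z ≠ 1 ∧ (P.map (fun a : ℝ => (a : ℂ))).charpoly.IsRoot z ∧ r = ‖z‖})⁻¹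

/-- Separation (or total-variation) cutoff for a sequence of chains with distance
functions `d n` and mixing times `ts n`. -/
def HasCutoff (d : ℕ → ℕ → ℝ) (ts : ℕ → ℕ) : Prop :=
  ∀ α : ℝ, 0 ≤ α →
    (α < 1 → Tendsto (fun n => d n ⌊α * (ts n : ℝ)⌋₊) atTop (nhds 1)) ∧
    (1 < α → Tendsto (fun n => d n ⌊α * (ts n : ℝ)⌋₊) atTop (nhds 0))

end ARW
namespace ARW

/-! ### Auxiliary lemmas -/

section Aux

variable {V : Type} [Fintype V] [DecidableEq V]

/-- Splitting a list into nil or cons. -/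
def listSplit (α : Type) : Unit ⊕ (α × List α) ≃ List α where
  toFun := Sum.elim (fun _ => []) (fun p => p.1 :: p.2)
  invFun := fun l => match l with
    | [] => Sum.inl ()
    | a :: l => Sum.inr (a, l)
  left_inv := by rintro (_ | ⟨a, l⟩) <;> rfl
  right_inv := by rintro (_ | ⟨a, l⟩) <;> rfl


theorem tsum_list (f : List V → ℝ≥0∞) :
    ∑' w, f w = f [] + ∑ x, ∑' xs, f (x :: xs) := by
  rw [← (listSplit V).tsum_eq f, Summable.tsum_sum ENNReal.summable ENNReal.summable,
    ENNReal.tsum_prod', tsum_fintype, tsum_fintype]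
  simp [listSplit]


theorem pathTotal_eq (K : V → V → ℝ≥0∞) (x : V) :
    ∑' xs, pathProb K x xs = (1 - ∑ y, K x y) + ∑ y, K x y * ∑' xs, pathProb K y xs := by
  rw [tsum_list]
  simp only [pathProb, ENNReal.tsum_mul_left]


theorem pathTrunc_le (K : V → V → ℝ≥0∞) (hsub : SubStochastic K) (n : ℕ) : ∀ x : V,
    ∑' xs, (if xs.length < n then pathProb K x xs else 0) ≤ 1 := by
  induction n with
  | zero => intro x; simp
  | succ n ih =>
    intro x
    rw [tsum_list]
    simp only [List.length_nil, Nat.zero_lt_succ, if_true, List.length_cons,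
      Nat.add_lt_add_iff_right, pathProb]
    calc _ = (1 - ∑ y, K x y) + ∑ y, K x y *
          ∑' xs, (if xs.length < n then pathProb K y xs else 0) := by
            congr 1
            apply Finset.sum_congr rfl
            intro y _
            rw [← ENNReal.tsum_mul_left]
            simp only [mul_ite, mul_zero]
      _ ≤ (1 - ∑ y, K x y) + ∑ y, K x y * 1 := by
            gcongr with y _
            exact ih y
      _ = 1 := by
            simp only [mul_one]
            exact tsub_add_cancel_of_le (hsub x)


theorem pathTotal_le (K : V → V → ℝ≥0∞) (hsub : SubStochastic K) (x : V) :
    ∑' xs, pathProb K x xs ≤ 1 := by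
  rw [ENNReal.tsum_eq_iSup_sum]
  refine iSup_le fun s => ?_
  refine le_trans ?_ (pathTrunc_le K hsub (s.sup List.length + 1) x)
  refine le_trans (le_of_eq ?_) (ENNReal.sum_le_tsum s)
  apply Finset.sum_congr rfl
  intro w hw
  rw [if_pos]
  exact Nat.lt_succ_of_le (Finset.le_sup (f := List.length) hw)

theorem pathTotal_one (K : V → V → ℝ≥0∞) (hsub : SubStochastic K) (hnd : NonDegenerate K)
    (x : V) : ∑' xs, pathProb K x xs = 1 := by
  set t : V → ℝ≥0∞ := fun x => ∑' xs, pathProb K x xs with ht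
  have hle : ∀ x, t x ≤ 1 := pathTotal_le K hsub
  have heq : ∀ x, t x = (1 - ∑ y, K x y) + ∑ y, K x y * t y := pathTotal_eq K
  have htt : ∀ x, t x ≠ ⊤ := fun x => ne_top_of_le_ne_top ENNReal.one_ne_top (hle x)
  have hK1 : ∀ x y, K x y ≤ 1 := fun x y =>
    le_trans (Finset.single_le_sum (f := K x) (fun _ _ => zero_le) (Finset.mem_univ y)) (hsub x)
  have hKt : ∀ x y, K x y ≠ ⊤ := fun x y => ne_top_of_le_ne_top ENNReal.one_ne_top (hK1 x y)
  set u : V → ℝ := fun x => 1 - (t x).toReal with hu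
  have hu0 : ∀ x, 0 ≤ u x := fun x => by
    have := ENNReal.toReal_mono ENNReal.one_ne_top (hle x)
    simp only [ENNReal.toReal_one] at this
    simp only [hu]; linarith
  have hsumr : ∀ x, (∑ y, K x y).toReal = ∑ y, (K x y).toReal := fun x =>
    ENNReal.toReal_sum (fun y _ => hKt x y)
  have hsumle : ∀ x, ∑ y, (K x y).toReal ≤ 1 := fun x => by
    rw [← hsumr]
    simpa using ENNReal.toReal_mono ENNReal.one_ne_top (hsub x)
  have hueq : ∀ x, u x = ∑ y, (K x y).toReal * u y := fun x => by
    have h1 := congrArg ENNReal.toReal (heq x)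
    rw [ENNReal.toReal_add (ENNReal.sub_ne_top ENNReal.one_ne_top)
      (ENNReal.sum_ne_top.2 fun y _ => ENNReal.mul_ne_top (hKt x y) (htt y)),
      ENNReal.toReal_sub_of_le (hsub x) ENNReal.one_ne_top, hsumr,
      ENNReal.toReal_sum (fun y _ => ENNReal.mul_ne_top (hKt x y) (htt y))] at h1
    simp only [ENNReal.toReal_mul, ENNReal.toReal_one] at h1
    simp only [hu, mul_sub, Finset.sum_sub_distrib, mul_one]
    linarith
  have : Nonempty V := ⟨x⟩
  obtain ⟨z, hz⟩ := Finite.exists_max u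
  by_cases hm : u z ≤ 0
  · have h1 : u x = 0 := le_antisymm ((hz x).trans hm) (hu0 x)
    have h2 : (t x).toReal = 1 := by simp only [hu] at h1; linarith
    have := (ENNReal.toReal_eq_one_iff (t x)).1 h2
    exact this
  · push Not at hm
    exfalso
    obtain ⟨a, ha, hne⟩ := hnd (Finset.univ.filter fun a => u a = u z) ⟨z, by simp⟩
    simp only [Finset.mem_filter, Finset.mem_univ, true_and] at ha
    apply hne
    have hnn : ∀ y, 0 ≤ (K a y).toReal * (u z - u y) := fun y =>
      mul_nonneg ENNReal.toReal_nonneg (sub_nonneg.2 (hz y))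
    have hS : ∑ y, (K a y).toReal * (u z - u y) = (∑ y, (K a y).toReal) * u z - u z := by
      simp only [mul_sub, Finset.sum_sub_distrib]
      rw [← hueq a, ha, Finset.sum_mul]
    have hpos : 0 ≤ ∑ y, (K a y).toReal * (u z - u y) := Finset.sum_nonneg fun y _ => hnn y
    have hone : ∑ y, (K a y).toReal = 1 := by
      apply le_antisymm (hsumle a)
      by_contra hlt
      push Not at hlt
      nlinarith
    have hzero : ∑ y, (K a y).toReal * (u z - u y) = 0 := by rw [hS, hone]; ring
    have hz' := (Finset.sum_eq_zero_iff_of_nonneg (fun y _ => hnn y)).1 hzero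
    have hout : ∀ y, u y ≠ u z → K a y = 0 := fun y hy => by
      have h3 := hz' y (Finset.mem_univ y)
      rcases mul_eq_zero.1 h3 with h | h
      · rcases (ENNReal.toReal_eq_zero_iff _).1 h with h | h
        · exact h
        · exact absurd h (hKt a y)
      · exact absurd (by linarith) hy
    have : ∑ y ∈ Finset.univ.filter (fun b => u b = u z), K a y = ∑ y, K a y := by
      apply Finset.sum_subset (Finset.subset_univ _)
      intro y _ hy
      apply hout
      simpa using hy
    rw [this]
    apply (ENNReal.toReal_eq_one_iff _).1
    rw [hsumr, hone]

theorem walkTotal_one (K : V → V → ℝ≥0∞) (hsub : SubStochastic K) (hnd : NonDegenerate K)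
    (ν : V → ℝ≥0∞) (hν : IsProbVec ν) : ∑' w, walkProb K ν w = 1 := by
  rw [tsum_list]
  simp only [walkProb, ENNReal.tsum_mul_left, pathTotal_one K hsub hnd, mul_one, zero_add]
  exact hν

theorem idlaUpdate_cases (A : Finset V) (w : List V) :
    (idlaUpdate A w = A ∧ ∀ x ∈ w, x ∈ A) ∨
      ∃ x, x ∉ A ∧ x ∈ w ∧ idlaUpdate A w = insert x A := by
  induction w with
  | nil => left; simp [idlaUpdate]
  | cons a l ih =>
    by_cases ha : a ∈ A
    · simp only [idlaUpdate, if_pos ha]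
      rcases ih with ⟨h1, h2⟩ | ⟨x, h1, h2, h3⟩
      · left; refine ⟨h1, ?_⟩
        intro x hx
        rcases List.mem_cons.1 hx with rfl | hx
        · exact ha
        · exact h2 x hx
      · right; exact ⟨x, h1, List.mem_cons_of_mem _ h2, h3⟩
    · right
      exact ⟨a, ha, by simp, by simp [idlaUpdate, ha]⟩

/-- One-step transition probabilities of IDLA. -/
noncomputable def idlaQ (K : V → V → ℝ≥0∞) (ν : V → ℝ≥0∞) (A B : Finset V) : ℝ≥0∞ :=
  ∑' w, if idlaUpdate A w = B then walkProb K ν w else 0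

theorem insert_inj_compl {A : Finset V} {x y : V} (hx : x ∉ A) (h : insert x A = insert y A) :
    x = y := by
  have : x ∈ insert y A := h ▸ Finset.mem_insert_self x A
  rcases Finset.mem_insert.1 this with h | h
  · exact h
  · exact absurd h hx

theorem step_expect (K : V → V → ℝ≥0∞) (ν : V → ℝ≥0∞) (A : Finset V) (φ : Finset V → ℝ≥0∞) :
    ∑' w, walkProb K ν w * φ (idlaUpdate A w) =
      idlaQ K ν A A * φ A + ∑ x ∈ Aᶜ, idlaQ K ν A (insert x A) * φ (insert x A) := by
  unfold idlaQ
  simp only [← ENNReal.tsum_mul_right]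
  rw [← Summable.tsum_finsetSum (fun _ _ => ENNReal.summable), ← ENNReal.tsum_add]
  congr 1
  funext w
  rcases idlaUpdate_cases A w with ⟨h, -⟩ | ⟨x, hx, -, h⟩
  · rw [h, if_pos rfl, Finset.sum_eq_zero, add_zero]
    intro x hx
    rw [if_neg, zero_mul]
    intro h2
    exact (Finset.mem_compl.1 hx) (h2 ▸ Finset.mem_insert_self x A)
  · rw [h, if_neg, zero_mul, zero_add, Finset.sum_eq_single x]
    · rw [if_pos rfl]
    · intro y _ hyx
      rw [if_neg, zero_mul]
      intro h2
      exact hyx (insert_inj_compl hx h2).symm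
    · intro h2
      exact absurd (Finset.mem_compl.2 hx) h2
    · intro h2
      exact hx (h2 ▸ Finset.mem_insert_self x A)

theorem idlaQ_le (K : V → V → ℝ≥0∞) (ν : V → ℝ≥0∞) (A : Finset V) (x : V) (hx : x ∉ A) :
    idlaQ K ν A (insert x A) ≤ hitProb K ν x := by
  unfold idlaQ hitProb
  refine ENNReal.tsum_le_tsum fun w => ?_
  split_ifs with h1 h2
  · exact le_rfl
  · exfalso
    rcases idlaUpdate_cases A w with ⟨h, -⟩ | ⟨y, hy, hyw, h⟩
    · rw [h] at h1
      exact hx (h1 ▸ Finset.mem_insert_self x A)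
    · rw [h] at h1
      exact h2 (insert_inj_compl hy h1 ▸ hyw)
  · exact zero_le
  · exact le_rfl

theorem hit_le_idlaQ (K : V → V → ℝ≥0∞) (ν : V → ℝ≥0∞) (A : Finset V) (x : V) (hx : x ∉ A) :
    hitProb K ν x ≤ ∑ y ∈ Aᶜ, idlaQ K ν A (insert y A) := by
  unfold idlaQ hitProb
  rw [← Summable.tsum_finsetSum (fun _ _ => ENNReal.summable)]
  refine ENNReal.tsum_le_tsum fun w => ?_
  split_ifs with h1
  · rcases idlaUpdate_cases A w with ⟨-, h⟩ | ⟨y, hy, hyw, h⟩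
    · exact absurd (h x h1) hx
    · refine le_trans ?_ (Finset.single_le_sum (fun _ _ => zero_le) (Finset.mem_compl.2 hy))
      rw [if_pos h]
  · exact zero_le

theorem idlaTail_zero (K : V → V → ℝ≥0∞) (ν : V → ℝ≥0∞) (A : Finset V) :
    idlaTail K ν A 0 = if A = Finset.univ then 0 else 1 := by
  unfold idlaTail
  rw [tsum_fintype]
  simp [idlaSet]

theorem idlaTail_succ (K : V → V → ℝ≥0∞) (ν : V → ℝ≥0∞) (A : Finset V) (t : ℕ) :
    idlaTail K ν A (t + 1) = ∑' w, walkProb K ν w * idlaTail K ν (idlaUpdate A w) t := by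
  unfold idlaTail
  rw [← (Fin.consEquiv (fun _ : Fin (t + 1) => List V)).tsum_eq, ENNReal.tsum_prod']
  congr 1
  funext w
  rw [← ENNReal.tsum_mul_left]
  congr 1
  funext ws
  simp only [Fin.consEquiv, Equiv.coe_fn_mk, Fin.prod_univ_succ, List.ofFn_succ, idlaSet,
    Fin.cons_zero, Fin.cons_succ, List.foldl_cons]
  rw [mul_assoc]
  rfl

/-- Existence of the comparison function (expected maximum of independent exponentials). -/
noncomputable def compAux (p : V → ℝ) : ℕ → Finset V → ℝ
  | 0, _ => 0
  | k + 1, R => (1 + ∑ x ∈ R, p x * compAux p k (R.erase x)) / ∑ x ∈ R, p x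

theorem exists_comp (p : V → ℝ) (hp : ∀ x, 0 < p x) : ∃ h : Finset V → ℝ, h ∅ = 0 ∧
    ∀ R : Finset V, R.Nonempty →
      h R * ∑ x ∈ R, p x = 1 + ∑ x ∈ R, p x * h (R.erase x) := by
  refine ⟨fun R => compAux p R.card R, by simp [compAux], ?_⟩
  intro R hR
  have hP : 0 < ∑ x ∈ R, p x := Finset.sum_pos (fun x _ => hp x) hR
  obtain ⟨k, hk⟩ : ∃ k, R.card = k + 1 := Nat.exists_eq_succ_of_ne_zero hR.card_pos.ne'
  simp only [hk, compAux]
  rw [div_mul_cancel₀ _ hP.ne']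
  congr 1
  apply Finset.sum_congr rfl
  intro x hx
  rw [Finset.card_erase_of_mem hx, hk]
  rfl

theorem comp_nonneg (p : V → ℝ) (hp : ∀ x, 0 < p x) (h : Finset V → ℝ) (h0 : h ∅ = 0)
    (hrec : ∀ R : Finset V, R.Nonempty →
      h R * ∑ x ∈ R, p x = 1 + ∑ x ∈ R, p x * h (R.erase x)) (R : Finset V) : 0 ≤ h R := by
  induction R using Finset.strongInduction with
  | H R ih =>
    rcases R.eq_empty_or_nonempty with rfl | hR
    · exact h0.ge
    · have hP : 0 < ∑ x ∈ R, p x := Finset.sum_pos (fun x _ => hp x) hR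
      have h1 : 0 ≤ ∑ x ∈ R, p x * h (R.erase x) := Finset.sum_nonneg fun x hx =>
        mul_nonneg (hp x).le (ih _ (Finset.erase_ssubset hx))
      have h2 := hrec R hR
      by_contra hlt
      push Not at hlt
      nlinarith

theorem comp_mono (p : V → ℝ) (hp : ∀ x, 0 < p x) (h : Finset V → ℝ) (h0 : h ∅ = 0)
    (hrec : ∀ R : Finset V, R.Nonempty →
      h R * ∑ x ∈ R, p x = 1 + ∑ x ∈ R, p x * h (R.erase x)) (R : Finset V) :
    ∀ x ∈ R, h (R.erase x) ≤ h R := by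
  induction R using Finset.strongInduction with
  | H R ih =>
    intro x hx
    rcases (R.erase x).eq_empty_or_nonempty with he | hne
    · rw [he, h0]; exact comp_nonneg p hp h h0 hrec R
    · have hP : 0 < ∑ x ∈ R, p x := Finset.sum_pos (fun x _ => hp x) ⟨x, hx⟩
      have h1 := hrec R ⟨x, hx⟩
      have h2 := hrec (R.erase x) hne
      have h3 : ∑ y ∈ R.erase x, p y * h ((R.erase x).erase y) ≤
          ∑ y ∈ R.erase x, p y * h (R.erase y) := by
        apply Finset.sum_le_sum
        intro y hy
        apply mul_le_mul_of_nonneg_left _ (hp y).le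
        rw [Finset.erase_right_comm]
        have hyx := Finset.mem_erase.1 hy
        exact ih _ (Finset.erase_ssubset hyx.2) x (Finset.mem_erase.2 ⟨hyx.1.symm, hx⟩)
      rw [← Finset.add_sum_erase R _ hx] at h1
      rw [← Finset.add_sum_erase R (fun y => p y * h (R.erase y)) hx] at h1
      have hP' : 0 < p x + ∑ y ∈ R.erase x, p y := by
        rw [Finset.add_sum_erase R _ hx]; exact hP
      refine le_of_mul_le_mul_right ?_ hP'
      rw [h1, mul_add, h2]
      linarith [mul_comm (p x) (h (R.erase x))]

theorem comp_lower (p : V → ℝ) (hp : ∀ x, 0 < p x) (h : Finset V → ℝ) (h0 : h ∅ = 0)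
    (hrec : ∀ R : Finset V, R.Nonempty →
      h R * ∑ x ∈ R, p x = 1 + ∑ x ∈ R, p x * h (R.erase x)) (R : Finset V) :
    (R.card : ℝ) * (harmonic R.card : ℝ) ≤ h R * ∑ x ∈ R, p x := by
  induction R using Finset.strongInduction with
  | H R ih =>
    rcases R.eq_empty_or_nonempty with rfl | hR
    · simp
    obtain ⟨k, hk⟩ : ∃ k, R.card = k + 1 := Nat.exists_eq_succ_of_ne_zero hR.card_pos.ne'
    rw [hrec R hR, hk, harmonic_succ]
    push_cast
    have hk1 : (0 : ℝ) < k + 1 := by positivity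
    have hL : ((k : ℝ) + 1) * ((harmonic k : ℝ) + ((k : ℝ) + 1)⁻¹) =
        1 + (k + 1) * harmonic k := by
      field_simp; ring
    rw [hL]
    rcases Nat.eq_zero_or_pos k with rfl | hkpos
    · have : 0 ≤ ∑ x ∈ R, p x * h (R.erase x) := Finset.sum_nonneg fun x hx =>
        mul_nonneg (hp x).le (comp_nonneg p hp h h0 hrec _)
      simpa using this
    have hkr : (0 : ℝ) < k := by exact_mod_cast hkpos
    set P := ∑ x ∈ R, p x with hPdef
    have hP : 0 < P := Finset.sum_pos (fun x _ => hp x) hR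
    have ha : ∀ x ∈ R, ∑ y ∈ R.erase x, p y = P - p x := fun x hx => by
      rw [hPdef, ← Finset.add_sum_erase R _ hx]; ring
    have hapos : ∀ x ∈ R, 0 < P - p x := fun x hx => by
      rw [← ha x hx]
      apply Finset.sum_pos (fun x _ => hp x)
      rw [← Finset.card_pos, Finset.card_erase_of_mem hx, hk]; omega
    have hH : (0 : ℝ) ≤ harmonic k := by
      have := (harmonic_pos hkpos.ne').le
      exact_mod_cast this
    have hstep : ∀ x ∈ R, (k * (harmonic k : ℝ)) * (P * (1 ^ 2 / (P - p x)) - 1) ≤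
        p x * h (R.erase x) := fun x hx => by
      have h1 := ih _ (Finset.erase_ssubset hx)
      rw [ha x hx, Finset.card_erase_of_mem hx, hk, Nat.add_sub_cancel] at h1
      have h2 := hapos x hx
      have h3 : P * (1 ^ 2 / (P - p x)) - 1 = p x / (P - p x) := by
        field_simp; ring
      rw [h3, ← mul_div_assoc, div_le_iff₀ h2]
      nlinarith [hp x]
    have hsum := Finset.sum_le_sum hstep
    rw [← Finset.mul_sum, Finset.sum_sub_distrib, ← Finset.mul_sum] at hsum
    have hcs := Finset.sq_sum_div_le_sum_sq_div R (fun _ => (1 : ℝ)) hapos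
    have hsa : ∑ x ∈ R, (P - p x) = k * P := by
      rw [Finset.sum_sub_distrib, ← hPdef]
      simp [hk]; ring
    rw [hsa] at hcs
    simp only [Finset.sum_const, hk, nsmul_eq_mul, mul_one, Nat.cast_add, Nat.cast_one] at hcs hsum
    have h4 : ((k : ℝ) + 1) ^ 2 / k ≤ P * ∑ x ∈ R, 1 ^ 2 / (P - p x) := by
      calc ((k : ℝ) + 1) ^ 2 / k = P * (((k : ℝ) + 1) ^ 2 / (k * P)) := by field_simp
        _ ≤ _ := mul_le_mul_of_nonneg_left hcs hP.le
    have h5 : ((k : ℝ) + 1) * harmonic k =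
        k * (harmonic k : ℝ) * (((k : ℝ) + 1) ^ 2 / k - (k + 1)) := by
      field_simp; ring
    have h6 : k * (harmonic k : ℝ) * (((k : ℝ) + 1) ^ 2 / k - (k + 1)) ≤
        k * (harmonic k : ℝ) * (P * ∑ x ∈ R, 1 ^ 2 / (P - p x) - (k + 1)) := by
      apply mul_le_mul_of_nonneg_left _ (by positivity)
      linarith
    linarith

theorem log_bound (n : ℕ) :
    Real.log n - Real.log (Real.log n) - 1 ≤ harmonic n := by
  rcases Nat.lt_or_ge n 2 with h | h
  · have : (0 : ℝ) ≤ harmonic n := by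
      interval_cases n <;> simp
    interval_cases n <;> simp at *
  · have h1 := log_add_one_le_harmonic n
    have hn : (2 : ℝ) ≤ n := by exact_mod_cast h
    have h2 : Real.log n ≤ Real.log (↑(n + 1)) := by
      apply Real.log_le_log (by linarith)
      push_cast; linarith
    have h3 : Real.log 2 ≤ Real.log n := Real.log_le_log (by norm_num) hn
    have h4 : (1 / 2 : ℝ) ≤ Real.log n := by linarith [Real.log_two_gt_d9]
    have h5 := Real.one_sub_inv_le_log_of_pos (show 0 < Real.log n by linarith)
    have h6 : (Real.log n)⁻¹ ≤ 2 := by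
      rw [inv_le_comm₀ (by linarith) (by norm_num)]
      linarith
    linarith

section Main

variable (K : V → V → ℝ≥0∞) (ν : V → ℝ≥0∞)

theorem idlaQ_total (h1 : ∑' w, walkProb K ν w = 1) (A : Finset V) :
    idlaQ K ν A A + ∑ x ∈ Aᶜ, idlaQ K ν A (insert x A) = 1 := by
  have := step_expect K ν A (fun _ => 1)
  simp only [mul_one] at this
  rw [← this, h1]

theorem idlaTail_univ (t : ℕ) : idlaTail K ν Finset.univ t = 0 := by
  induction t with
  | zero => simp [idlaTail_zero]
  | succ t ih => rw [idlaTail_succ, step_expect K ν Finset.univ (fun B => idlaTail K ν B t)]; simp [ih]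

theorem partial_le (h1 : ∑' w, walkProb K ν w = 1) (hadm : Admissible K ν)
    (hfin : ∀ x, hitProb K ν x ≠ ⊤) (N : ℕ) : ∀ A : Finset V,
    ∑ t ∈ Finset.range N, idlaTail K ν A t ≤ (Aᶜ.card : ℝ≥0∞) * ∑ x, (hitProb K ν x)⁻¹ := by
  set c := ∑ x, (hitProb K ν x)⁻¹ with hc
  induction N with
  | zero => intro A; simp
  | succ N ih =>
    intro A
    by_cases hA : A = Finset.univ
    · subst hA; simp [idlaTail_univ]
    rw [Finset.sum_range_succ']
    simp only [idlaTail_succ]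
    rw [← Summable.tsum_finsetSum (fun _ _ => ENNReal.summable)]
    simp only [← Finset.mul_sum]
    rw [idlaTail_zero, if_neg hA]
    obtain ⟨x0, hx0⟩ : ∃ x, x ∉ A := by
      by_contra hcon
      push Not at hcon
      exact hA (Finset.eq_univ_iff_forall.2 hcon)
    have hone : 1 ≤ ∑ x ∈ Aᶜ, idlaQ K ν A (insert x A) * c := by
      rw [← Finset.sum_mul]
      calc (1 : ℝ≥0∞) = hitProb K ν x0 * (hitProb K ν x0)⁻¹ :=
            (ENNReal.mul_inv_cancel (hadm x0).ne' (hfin x0)).symm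
        _ ≤ _ := by
            apply mul_le_mul' (hit_le_idlaQ K ν A x0 hx0)
            exact Finset.single_le_sum (f := fun x => (hitProb K ν x)⁻¹)
              (fun _ _ => zero_le) (Finset.mem_univ x0)
    have hcard : ∀ x ∈ Aᶜ, (Aᶜ.card : ℝ≥0∞) * c = ((insert x A)ᶜ.card : ℝ≥0∞) * c + c := by
      intro x hx
      rw [Finset.compl_insert, ← Finset.card_erase_add_one hx]
      push_cast; ring
    calc _ ≤ ∑' w, walkProb K ν w * (((idlaUpdate A w)ᶜ.card : ℝ≥0∞) * c) + 1 := by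
          gcongr with w
          exact ih _
      _ = idlaQ K ν A A * ((Aᶜ.card : ℝ≥0∞) * c) +
          ∑ x ∈ Aᶜ, idlaQ K ν A (insert x A) * (((insert x A)ᶜ.card : ℝ≥0∞) * c) + 1 := by
          rw [step_expect K ν A (fun B => (Bᶜ.card : ℝ≥0∞) * c)]
      _ ≤ idlaQ K ν A A * ((Aᶜ.card : ℝ≥0∞) * c) +
          ∑ x ∈ Aᶜ, idlaQ K ν A (insert x A) * (((insert x A)ᶜ.card : ℝ≥0∞) * c) +
          ∑ x ∈ Aᶜ, idlaQ K ν A (insert x A) * c := by gcongr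
      _ = idlaQ K ν A A * ((Aᶜ.card : ℝ≥0∞) * c) +
          ∑ x ∈ Aᶜ, idlaQ K ν A (insert x A) * ((Aᶜ.card : ℝ≥0∞) * c) := by
          rw [add_assoc, ← Finset.sum_add_distrib]
          congr 1
          apply Finset.sum_congr rfl
          intro x hx
          rw [hcard x hx]; ring
      _ = _ := by
          rw [← Finset.sum_mul, ← add_mul, idlaQ_total K ν h1, one_mul]

theorem idlaMean_ne_top (h1 : ∑' w, walkProb K ν w = 1) (hadm : Admissible K ν)
    (hfin : ∀ x, hitProb K ν x ≠ ⊤) (A : Finset V) : idlaMean K ν A ≠ ⊤ := by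
  have hle : idlaMean K ν A ≤ (Aᶜ.card : ℝ≥0∞) * ∑ x, (hitProb K ν x)⁻¹ := by
    unfold idlaMean
    rw [ENNReal.tsum_eq_iSup_nat]
    exact iSup_le fun N => partial_le K ν h1 hadm hfin N A
  refine ne_top_of_le_ne_top ?_ hle
  refine ENNReal.mul_ne_top (ENNReal.natCast_ne_top _) (ENNReal.sum_ne_top.2 fun x _ => ?_)
  exact ENNReal.inv_ne_top.2 (hadm x).ne'

theorem idlaMean_step (A : Finset V) (hA : A ≠ Finset.univ) :
    idlaMean K ν A = 1 + (idlaQ K ν A A * idlaMean K ν A +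
      ∑ x ∈ Aᶜ, idlaQ K ν A (insert x A) * idlaMean K ν (insert x A)) := by
  rw [← step_expect K ν A (idlaMean K ν)]
  conv_lhs => unfold idlaMean
  rw [tsum_eq_zero_add' ENNReal.summable, idlaTail_zero, if_neg hA]
  simp only [idlaTail_succ]
  rw [ENNReal.tsum_comm]
  simp only [ENNReal.tsum_mul_left, idlaMean]

theorem mean_ge_comp (h1 : ∑' w, walkProb K ν w = 1) (hadm : Admissible K ν)
    (hfin : ∀ x, hitProb K ν x ≠ ⊤) (h : Finset V → ℝ) (h0 : h ∅ = 0)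
    (hrec : ∀ R : Finset V, R.Nonempty → h R * ∑ x ∈ R, (hitProb K ν x).toReal =
      1 + ∑ x ∈ R, (hitProb K ν x).toReal * h (R.erase x)) (R : Finset V) :
    h R ≤ (idlaMean K ν Rᶜ).toReal := by
  have hp : ∀ x, 0 < (hitProb K ν x).toReal := fun x => ENNReal.toReal_pos (hadm x).ne' (hfin x)
  induction R using Finset.strongInduction with
  | H R ih =>
    rcases R.eq_empty_or_nonempty with rfl | hR
    · rw [h0]; exact ENNReal.toReal_nonneg
    obtain ⟨x0, hx0⟩ := hR
    set A := Rᶜ with hAdef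
    have hRA : Aᶜ = R := by simp [hAdef]
    have hx0A : x0 ∉ A := by simpa [hAdef] using hx0
    have hA : A ≠ Finset.univ := fun hh => hx0A (hh ▸ Finset.mem_univ x0)
    have hM := idlaMean_ne_top K ν h1 hadm hfin
    have htot := idlaQ_total K ν h1 A
    have hstep := idlaMean_step K ν A hA
    have hhit := hit_le_idlaQ K ν A x0 hx0A
    rw [hRA] at htot hstep hhit
    have hq0 : idlaQ K ν A A ≠ ⊤ :=
      ne_top_of_le_ne_top ENNReal.one_ne_top (htot ▸ le_self_add)
    have hqS : ∑ x ∈ R, idlaQ K ν A (insert x A) ≠ ⊤ :=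
      ne_top_of_le_ne_top ENNReal.one_ne_top (htot ▸ le_add_self)
    have hq : ∀ x ∈ R, idlaQ K ν A (insert x A) ≠ ⊤ := ENNReal.sum_ne_top.1 hqS
    have hql : ∀ x ∈ R, (idlaQ K ν A (insert x A)).toReal ≤ (hitProb K ν x).toReal :=
      fun x hx => ENNReal.toReal_mono (hfin x)
        (idlaQ_le K ν A x (by simpa [hAdef] using hx))
    have hpos := (hp x0).trans_le (ENNReal.toReal_mono hqS hhit)
    rw [ENNReal.toReal_sum hq] at hpos
    have htot' := congrArg ENNReal.toReal htot
    rw [ENNReal.toReal_add hq0 hqS, ENNReal.toReal_sum hq, ENNReal.toReal_one] at htot'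
    have hmt : ∀ x ∈ R, idlaQ K ν A (insert x A) * idlaMean K ν (insert x A) ≠ ⊤ :=
      fun x hx => ENNReal.mul_ne_top (hq x hx) (hM _)
    have hstep' := congrArg ENNReal.toReal hstep
    rw [ENNReal.toReal_add ENNReal.one_ne_top (ENNReal.add_ne_top.2
      ⟨ENNReal.mul_ne_top hq0 (hM A), ENNReal.sum_ne_top.2 hmt⟩),
      ENNReal.toReal_add (ENNReal.mul_ne_top hq0 (hM A)) (ENNReal.sum_ne_top.2 hmt),
      ENNReal.toReal_sum hmt] at hstep'
    simp only [ENNReal.toReal_mul, ENNReal.toReal_one] at hstep'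
    have hlow : ∑ x ∈ R, (idlaQ K ν A (insert x A)).toReal * h (R.erase x) ≤
        ∑ x ∈ R, (idlaQ K ν A (insert x A)).toReal * (idlaMean K ν (insert x A)).toReal := by
      apply Finset.sum_le_sum
      intro x hx
      apply mul_le_mul_of_nonneg_left _ ENNReal.toReal_nonneg
      have := ih _ (Finset.erase_ssubset hx)
      rwa [Finset.compl_erase] at this
    have hup : ∑ x ∈ R, (idlaQ K ν A (insert x A)).toReal * (h R - h (R.erase x)) ≤ 1 := by
      calc _ ≤ ∑ x ∈ R, (hitProb K ν x).toReal * (h R - h (R.erase x)) := by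
            apply Finset.sum_le_sum
            intro x hx
            apply mul_le_mul_of_nonneg_right (hql x hx)
            exact sub_nonneg.2 (comp_mono _ hp h h0 hrec R x hx)
        _ = 1 := by
            simp only [mul_sub, Finset.sum_sub_distrib, ← Finset.sum_mul]
            linarith [hrec R ⟨x0, hx0⟩, mul_comm (h R) (∑ x ∈ R, (hitProb K ν x).toReal)]
    simp only [mul_sub, Finset.sum_sub_distrib, ← Finset.sum_mul] at hup
    set q := ∑ x ∈ R, (idlaQ K ν A (insert x A)).toReal with hqdef
    set m := (idlaMean K ν A).toReal
    have hr : (idlaQ K ν A A).toReal = 1 - q := by linarith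
    rw [hr] at hstep'
    refine le_of_mul_le_mul_left ?_ hpos
    linarith

end Main

end Aux

/-- **Lemma (A general lower bound).**  The filling time `T` of `IDLA(K,ν)` on a
network with `n = |V|` sites satisfies
`E[T] ≥ n (log n − log log n − 1) / Σ_x p(x)`. -/
theorem idla_mean_lower_bound
    {V : Type} [Fintype V] [DecidableEq V] [Nonempty V]
    (K : V → V → ℝ≥0∞) (hsub : SubStochastic K) (hnd : NonDegenerate K)
    (ν : V → ℝ≥0∞) (hν : IsProbVec ν) (hadm : Admissible K ν) :
    (Fintype.card V : ℝ)
        * (Real.log (Fintype.card V) - Real.log (Real.log (Fintype.card V)) - 1)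
        / (∑ x, hitProb K ν x).toReal
      ≤ (idlaMean K ν (∅ : Finset V)).toReal := by
  have h1 := walkTotal_one K hsub hnd ν hν
  have hfin : ∀ x, hitProb K ν x ≠ ⊤ := fun x => by
    refine ne_top_of_le_ne_top ENNReal.one_ne_top (h1 ▸ ?_)
    refine ENNReal.tsum_le_tsum fun w => ?_
    split_ifs
    · exact le_rfl
    · exact zero_le
  have hp : ∀ x, 0 < (hitProb K ν x).toReal := fun x => ENNReal.toReal_pos (hadm x).ne' (hfin x)
  obtain ⟨h, h0, hrec⟩ := exists_comp (fun x => (hitProb K ν x).toReal) hp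
  have hlow := comp_lower _ hp h h0 hrec Finset.univ
  have hge := mean_ge_comp K ν h1 hadm hfin h h0 hrec Finset.univ
  rw [Finset.compl_univ] at hge
  rw [ENNReal.toReal_sum (fun x _ => hfin x)]
  have hP : 0 < ∑ x, (hitProb K ν x).toReal :=
    Finset.sum_pos (fun x _ => hp x) Finset.univ_nonempty
  rw [div_le_iff₀ hP]
  rw [Finset.card_univ] at hlow
  have hb := mul_le_mul_of_nonneg_left (log_bound (Fintype.card V))
    (Nat.cast_nonneg (α := ℝ) (Fintype.card V))
  have hm := mul_le_mul_of_nonneg_right hge hP.le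
  linarith

end ARW
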